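/- Let α ∈ (0,1) and let J be an instance with agreeable deadlines in which every job is α-loose (p_j ≤ α·(d_j − r_j)), and suppose J admits a feasible nonpreemptive schedule on m machines. Then for every integer m′ ≥ m/(1−α)², the nonpreemptive EDF schedule of J on m′ machines completes every job by its deadline. -/

import Mathlib

/-- A job with release date `r`, deadline `d`, and processing time `p`. -/
structure Job where
  r : ℕ
  d : ℕ
  p : ℕ

/-- A job is valid if `1 ≤ p` and `p ≤ d - r` (i.e. `r + p ≤ d`). -/
def Job.valid (j : Job) : Prop := 1 ≤ j.p ∧ j.r + j.p ≤ j.d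

/-- The laxity `ℓ_j = d_j - r_j - p_j` of a job. -/
def Job.lax (j : Job) : ℕ := j.d - j.r - j.p

/-- A preemptive schedule of the instance `J` is feasible on `m` machines if at most `m`
jobs are processed in every slot, every job is only processed inside its window, and
every job is processed for exactly `p_j` slots. -/
def FeasiblePre {n : ℕ} (J : Fin n → Job) (m : ℕ) : Prop :=
  ∃ S : ℕ → Finset (Fin n),
    (∀ t, (S t).card ≤ m) ∧
    (∀ t j, j ∈ S t → (J j).r ≤ t ∧ t < (J j).d) ∧
    (∀ j, ((Finset.range (J j).d).filter (fun t => j ∈ S t)).card = (J j).p)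

/-- The minimum number of machines on which `J` admits a feasible preemptive schedule. -/
noncomputable def mOpt {n : ℕ} (J : Fin n → Job) : ℕ := sInf {m | FeasiblePre J m}

/-- From the set `A`, select the (at most) `m'` smallest elements w.r.t. the
(irreflexive, total) order `lt`. -/
def select {n : ℕ} (m' : ℕ) (lt : Fin n → Fin n → Prop) [DecidableRel lt]
    (A : Finset (Fin n)) : Finset (Fin n) :=
  A.filter (fun j => (A.filter fun k => lt k j).card < m')

/-- A nonpreemptive schedule (given by start times) of `J` is feasible on `m` machines
if each job runs inside its window and at every time at most `m` jobs are running. -/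
def FeasibleNP {n : ℕ} (J : Fin n → Job) (m : ℕ) : Prop :=
  ∃ s : Fin n → ℕ,
    (∀ j, (J j).r ≤ s j ∧ s j + (J j).p ≤ (J j).d) ∧
    (∀ t : ℕ, (Finset.univ.filter (fun j => s j ≤ t ∧ t < s j + (J j).p)).card ≤ m)

/-- EDF priority: smaller deadline first, ties broken by earlier release date,
then by lower index. -/
def edfLt {n : ℕ} (J : Fin n → Job) (a b : Fin n) : Prop :=
  (J a).d < (J b).d ∨
    ((J a).d = (J b).d ∧
      ((J a).r < (J b).r ∨ ((J a).r = (J b).r ∧ a < b)))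

instance {n : ℕ} (J : Fin n → Job) : DecidableRel (edfLt J) := fun a b => by
  unfold edfLt; infer_instance

/-- The state of the nonpreemptive EDF schedule on `m'` machines after the decisions
of times `0, …, t-1`: the pair of the set of jobs already started and the function
recording their start times. At each time `t`, jobs started before and unfinished
keep running, and the free machines are filled with the released, not yet started
jobs of smallest deadline (ties by release date, then index). -/
def npState {n : ℕ} (J : Fin n → Job) (m' : ℕ) :
    ℕ → Finset (Fin n) × (Fin n → ℕ)
  | 0 => (∅, fun _ => 0)
  | t + 1 =>
      let st := npState J m' t
      let running := st.1.filter (fun j => t < st.2 j + (J j).p)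
      let cand := Finset.univ.filter (fun j => j ∉ st.1 ∧ (J j).r ≤ t)
      let newlyStarted := select (m' - running.card) (edfLt J) cand
      (st.1 ∪ newlyStarted, fun j => if j ∈ newlyStarted then t else st.2 j)

/-- The number of slots before time `t` in which `k` is processed. -/
def work {n : ℕ} (run : ℕ → Finset (Fin n)) (k : Fin n) (t : ℕ) : ℕ :=
  ((Finset.range t).filter fun u => k ∈ run u).card

section Work

variable {n : ℕ} (run : ℕ → Finset (Fin n))

theorem work_zero (k : Fin n) : work run k 0 = 0 := by simp [work]

theorem work_succ (k : Fin n) (t : ℕ) :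
    work run k (t + 1) = work run k t + if k ∈ run t then 1 else 0 := by
  unfold work
  rw [Finset.range_add_one, Finset.filter_insert]
  split_ifs <;> simp

theorem work_mono (k : Fin n) : Monotone (work run k) :=
  monotone_nat_of_le_succ fun t => by rw [work_succ]; omega

theorem sum_work_succ (R : Finset (Fin n)) (t : ℕ) :
    ∑ k ∈ R, work run k (t + 1) = ∑ k ∈ R, work run k t + (R ∩ run t).card := by
  simp_rw [work_succ, Finset.sum_add_distrib]
  rw [← Finset.card_filter, Finset.filter_mem_eq_inter]

/-- Upper bound on the total work done by `m` machines in an interval. -/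
theorem sum_work_add_le (R : Finset (Fin n)) {m : ℕ} (hm : ∀ t, (run t).card ≤ m) (a b : ℕ) :
    ∑ k ∈ R, work run k (a + b) ≤ ∑ k ∈ R, work run k a + m * b := by
  induction b with
  | zero => simp
  | succ b ih =>
    have h : (R ∩ run (a + b)).card ≤ m :=
      (Finset.card_le_card Finset.inter_subset_right).trans (hm _)
    rw [← add_assoc, sum_work_succ, mul_add]
    omega

/-- Lower bound on the total work done in an interval during which all `m` machines are busy
whenever `k` is not processed. -/
theorem le_sum_work_add (R : Finset (Fin n)) {m : ℕ} (k : Fin n) (a b : ℕ)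
    (h : ∀ u < b, k ∈ run (a + u) ∨ m ≤ (R ∩ run (a + u)).card) :
    ∑ i ∈ R, work run i a + m * b ≤ ∑ i ∈ R, work run i (a + b) + m * work run k (a + b) := by
  induction b with
  | zero => simp
  | succ b ih =>
    have ih := ih fun u hu => h u (hu.trans (Nat.lt_succ_self b))
    rw [← add_assoc, sum_work_succ, work_succ, mul_add, mul_add]
    rcases h b (Nat.lt_succ_self b) with h | h
    · simp only [h, if_true]; omega
    · have := Nat.zero_le (m * if k ∈ run (a + b) then 1 else 0)
      omega

end Work

section Select

variable {n : ℕ} (c : ℕ) (lt : Fin n → Fin n → Prop) [DecidableRel lt] (A : Finset (Fin n))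

/-- If some candidate is not selected, then all places have been filled. -/
theorem le_card_select (hirr : ∀ a, ¬ lt a a) (htrans : ∀ a b c, lt a b → lt b c → lt a c)
    {k : Fin n} (hk : k ∈ A) (hks : k ∉ select c lt A) : c ≤ (select c lt A).card := by
  obtain ⟨i, hi, hmin⟩ := Finset.exists_min_image (A \ select c lt A)
    (fun k => (A.filter fun i => lt i k).card) ⟨k, by simp [hk, hks]⟩
  rw [Finset.mem_sdiff] at hi
  have hci : c ≤ (A.filter fun l => lt l i).card := by
    by_contra hlt
    exact hi.2 (Finset.mem_filter.2 ⟨hi.1, not_le.1 hlt⟩)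
  refine hci.trans (Finset.card_le_card fun l hl => ?_)
  rw [Finset.mem_filter] at hl
  by_contra hls
  refine absurd (hmin l (by simp [hl.1, hls])) (not_le.2 (Finset.card_lt_card ?_))
  rw [Finset.ssubset_iff_of_subset
    (Finset.monotone_filter_right _ fun x _ hx => htrans _ _ _ hx hl.2)]
  exact ⟨l, by simp [hl.1, hl.2], by simp [hirr]⟩

/-- The selection is closed under candidates of higher priority. -/
theorem mem_select_of_lt (htrans : ∀ a b c, lt a b → lt b c → lt a c) {i k : Fin n}
    (hk : k ∈ A) (hi : i ∈ select c lt A) (hki : lt k i) : k ∈ select c lt A := by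
  rw [select, Finset.mem_filter] at hi ⊢
  exact ⟨hk, (Finset.card_le_card
    (Finset.monotone_filter_right _ fun x _ hx => htrans _ _ _ hx hki)).trans_lt hi.2⟩

end Select

section EDF

variable {n : ℕ} (J : Fin n → Job)

theorem edfLt_irrefl (a : Fin n) : ¬ edfLt J a a := by simp [edfLt]

theorem edfLt_trans (a b c : Fin n) (hab : edfLt J a b) (hbc : edfLt J b c) : edfLt J a c := by
  unfold edfLt at *
  omega

variable (m' : ℕ)

/-- The jobs that continue processing at time `t`. -/
def npContinuing (t : ℕ) : Finset (Fin n) :=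
  (npState J m' t).1.filter fun j => t < (npState J m' t).2 j + (J j).p

/-- The released and not yet started jobs at time `t`. -/
def npCandidates (t : ℕ) : Finset (Fin n) :=
  Finset.univ.filter fun j => j ∉ (npState J m' t).1 ∧ (J j).r ≤ t

/-- The jobs started by EDF at time `t`. -/
def npStarting (t : ℕ) : Finset (Fin n) :=
  select (m' - (npContinuing J m' t).card) (edfLt J) (npCandidates J m' t)

/-- The jobs processed by EDF in the slot starting at time `t`. -/
def npRun (t : ℕ) : Finset (Fin n) :=
  (npState J m' (t + 1)).1.filter fun j => t < (npState J m' (t + 1)).2 j + (J j).p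

theorem npState_succ_fst (t : ℕ) :
    (npState J m' (t + 1)).1 = (npState J m' t).1 ∪ npStarting J m' t := rfl

theorem npState_succ_snd (t : ℕ) (j : Fin n) :
    (npState J m' (t + 1)).2 j = if j ∈ npStarting J m' t then t else (npState J m' t).2 j := rfl

theorem npStarting_subset (t : ℕ) : npStarting J m' t ⊆ npCandidates J m' t :=
  Finset.filter_subset _ _

variable {J m'}

theorem notMem_npStarting {t : ℕ} {j : Fin n} (hj : j ∈ (npState J m' t).1) :
    j ∉ npStarting J m' t := fun h => by
  simpa [npCandidates, hj] using npStarting_subset J m' t h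

theorem npState_succ_snd_of_mem {t : ℕ} {j : Fin n} (hj : j ∈ (npState J m' t).1) :
    (npState J m' (t + 1)).2 j = (npState J m' t).2 j := by
  rw [npState_succ_snd, if_neg (notMem_npStarting hj)]

theorem npState_start_bounds {t : ℕ} {j : Fin n} (hj : j ∈ (npState J m' t).1) :
    (J j).r ≤ (npState J m' t).2 j ∧ (npState J m' t).2 j < t := by
  induction t with
  | zero => simp [npState] at hj
  | succ t ih =>
    by_cases h : j ∈ (npState J m' t).1
    · rw [npState_succ_snd_of_mem h]
      have := ih h
      omega
    · have hs : j ∈ npStarting J m' t := by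
        rw [npState_succ_fst, Finset.mem_union] at hj
        exact hj.resolve_left h
      have hc := npStarting_subset J m' t hs
      rw [npCandidates, Finset.mem_filter] at hc
      rw [npState_succ_snd, if_pos hs]
      omega

theorem work_npRun (t : ℕ) (j : Fin n) : work (npRun J m') j t =
    if j ∈ (npState J m' t).1 then min (J j).p (t - (npState J m' t).2 j) else 0 := by
  induction t with
  | zero => simp [work_zero, npState]
  | succ t ih =>
    rw [work_succ, ih]
    simp only [npRun, Finset.mem_filter]
    by_cases h : j ∈ (npState J m' t).1
    · have h1 : j ∈ (npState J m' (t + 1)).1 := by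
        rw [npState_succ_fst]; exact Finset.mem_union_left _ h
      have := (npState_start_bounds h).2
      simp only [h, h1, if_true, true_and, npState_succ_snd_of_mem h]
      split_ifs <;> omega
    · by_cases h1 : j ∈ npStarting J m' t
      · have h2 : j ∈ (npState J m' (t + 1)).1 := by
          rw [npState_succ_fst]; exact Finset.mem_union_right _ h1
        simp only [h, h2, h1, if_true, if_false, true_and, npState_succ_snd]
        split_ifs <;> omega
      · have h2 : j ∉ (npState J m' (t + 1)).1 := by
          rw [npState_succ_fst, Finset.mem_union]; tauto
        simp [h, h2]

theorem work_npRun_le (t : ℕ) (j : Fin n) : work (npRun J m') j t ≤ (J j).p := by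
  rw [work_npRun]
  split_ifs <;> simp

theorem work_npRun_release (j : Fin n) : work (npRun J m') j (J j).r = 0 := by
  rw [work_npRun]
  split_ifs with h
  · have := npState_start_bounds h
    omega
  · rfl

theorem mem_npRun_of_work {t : ℕ} {j : Fin n} (h0 : 0 < work (npRun J m') j (t + 1))
    (hp : work (npRun J m') j (t + 1) < (J j).p) : j ∈ npRun J m' t := by
  rw [work_npRun] at h0 hp
  split_ifs at h0 hp with h
  · rw [npRun, Finset.mem_filter]
    exact ⟨h, by omega⟩
  · omega

/-- With agreeable deadlines, EDF starts jobs in order of priority. -/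
theorem not_edfLt_of_started (hagree : ∀ j k, (J j).r < (J k).r → (J j).d ≤ (J k).d)
    {t : ℕ} {i k : Fin n} (hi : i ∈ (npState J m' t).1) (hk : k ∉ (npState J m' t).1) :
    ¬ edfLt J k i := by
  induction t with
  | zero => simp [npState] at hi
  | succ t ih =>
    rw [npState_succ_fst, Finset.mem_union] at hi hk
    push Not at hk
    intro hlt
    rcases hi with hi | hi
    · exact ih hi hk.1 hlt
    · have hc := npStarting_subset J m' t hi
      simp only [npCandidates, Finset.mem_filter, Finset.mem_univ, true_and] at hc
      have hr : (J k).r ≤ (J i).r := by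
        by_contra hr
        have := hagree i k (not_le.1 hr)
        unfold edfLt at hlt
        omega
      refine hk.2 (mem_select_of_lt _ _ _ (edfLt_trans J) ?_ hi hlt)
      simp only [npCandidates, Finset.mem_filter, Finset.mem_univ, true_and]
      exact ⟨hk.1, hr.trans hc.2⟩

/-- While a released job waits, all machines are busy with jobs of no larger deadline. -/
theorem busy_of_waiting (hval : ∀ j, (J j).valid)
    (hagree : ∀ j k, (J j).r < (J k).r → (J j).d ≤ (J k).d)
    {t D : ℕ} {k : Fin n} (hr : (J k).r ≤ t) (hD : (J k).d ≤ D)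
    (hk : k ∉ (npState J m' (t + 1)).1) :
    m' ≤ ((Finset.univ.filter fun i => (J i).d ≤ D) ∩ npRun J m' t).card := by
  have hk' := hk
  rw [npState_succ_fst, Finset.mem_union] at hk'
  push Not at hk'
  have hcard : m' - (npContinuing J m' t).card ≤ (npStarting J m' t).card :=
    le_card_select _ _ _ (edfLt_irrefl J) (edfLt_trans J)
      (by simp only [npCandidates, Finset.mem_filter, Finset.mem_univ, true_and]
          exact ⟨hk'.1, hr⟩) hk'.2
  have hdisj : Disjoint (npContinuing J m' t) (npStarting J m' t) :=
    Finset.disjoint_left.2 fun i hi => notMem_npStarting (Finset.mem_filter.1 hi).1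
  have hsub : npContinuing J m' t ∪ npStarting J m' t ⊆ npRun J m' t := by
    intro i hi
    rw [npRun, Finset.mem_filter, npState_succ_fst, Finset.mem_union]
    rcases Finset.mem_union.1 hi with hi | hi
    · rw [npContinuing, Finset.mem_filter] at hi
      rw [npState_succ_snd_of_mem hi.1]
      exact ⟨Or.inl hi.1, hi.2⟩
    · rw [npState_succ_snd, if_pos hi]
      have := (hval i).1
      exact ⟨Or.inr hi, by omega⟩
  have hrun : npRun J m' t ⊆ (Finset.univ.filter fun i => (J i).d ≤ D) ∩ npRun J m' t := by
    intro i hi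
    have h := not_edfLt_of_started hagree (Finset.mem_filter.1 hi).1 hk
    simp only [Finset.mem_inter, Finset.mem_filter, Finset.mem_univ, true_and]
    refine ⟨?_, hi⟩
    unfold edfLt at h
    omega
  have := Finset.card_le_card (hsub.trans hrun)
  rw [Finset.card_union_of_disjoint hdisj] at this
  omega

theorem mem_npRun_or_busy (hval : ∀ j, (J j).valid)
    (hagree : ∀ j k, (J j).r < (J k).r → (J j).d ≤ (J k).d)
    {t D : ℕ} {k : Fin n} (hr : (J k).r ≤ t) (hD : (J k).d ≤ D)
    (hw : work (npRun J m') k t < (J k).p) :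
    k ∈ npRun J m' t ∨
      m' ≤ ((Finset.univ.filter fun i => (J i).d ≤ D) ∩ npRun J m' t).card := by
  by_cases hrun : k ∈ npRun J m' t
  · exact Or.inl hrun
  refine Or.inr (busy_of_waiting hval hagree hr hD fun hk => hrun ?_)
  have h := work_succ (npRun J m') k t
  rw [if_neg hrun, work_npRun (t + 1), if_pos hk] at h
  rw [npRun, Finset.mem_filter]
  exact ⟨hk, by omega⟩

end EDF

section Fixed

variable {n : ℕ} (J : Fin n → Job) (s : Fin n → ℕ)

/-- The jobs processed in slot `t` by the nonpreemptive schedule with start times `s`. -/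
def startRun (t : ℕ) : Finset (Fin n) :=
  Finset.univ.filter fun j => s j ≤ t ∧ t < s j + (J j).p

theorem work_startRun (j : Fin n) (t : ℕ) :
    work (startRun J s) j t = min (J j).p (t - s j) := by
  induction t with
  | zero => simp [work_zero]
  | succ t ih =>
    rw [work_succ, ih]
    simp only [startRun, Finset.mem_filter, Finset.mem_univ, true_and]
    split_ifs <;> omega

end Fixed

/-- EDF lags behind any feasible schedule on `m` machines by at most
`α / (1 - α) * m * (D - t)` at time `t`, counting jobs with deadline at most `D`. -/
theorem sum_work_le_add_lag {n : ℕ} {J : Fin n → Job}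
    (hval : ∀ j, (J j).valid)
    (hagree : ∀ j k, (J j).r < (J k).r → (J j).d ≤ (J k).d)
    {α : ℚ} (hα0 : 0 < α) (hα1 : α < 1)
    (hloose : ∀ j, ((J j).p : ℚ) ≤ α * (((J j).d : ℚ) - ((J j).r : ℚ)))
    {m m' : ℕ} {s : Fin n → ℕ} (hs : ∀ j, (J j).r ≤ s j)
    (hcap : ∀ t, (startRun J s t).card ≤ m)
    (hm' : (m : ℚ) / (1 - α) ^ 2 ≤ (m' : ℚ)) (D t : ℕ) (ht : t ≤ D) :
    ((∑ k with (J k).d ≤ D, work (startRun J s) k t : ℕ) : ℚ) ≤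
      (∑ k with (J k).d ≤ D, work (npRun J m') k t : ℕ) + α / (1 - α) * m * (D - t) := by
  have hβ : 0 < 1 - α := by linarith
  have hρ : 0 < α / (1 - α) := by positivity
  have hρ' : α / (1 - α) + 1 = 1 / (1 - α) := by field_simp; ring
  have hm'' : (m : ℚ) / (1 - α) ≤ m' * (1 - α) := by
    rw [div_le_iff₀ (by positivity)] at hm'
    rw [div_le_iff₀ hβ]
    linarith
  have hm0 : (0 : ℚ) ≤ m := Nat.cast_nonneg m
  induction t using Nat.strong_induction_on with
  | _ t ih =>
  have htD : (0 : ℚ) ≤ D - t := by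
    have : (t : ℚ) ≤ D := by exact_mod_cast ht
    linarith
  set R : Finset (Fin n) := Finset.univ.filter fun k => (J k).d ≤ D with hR
  set X : Finset (Fin n) :=
    R.filter fun k => work (npRun J m') k t < work (startRun J s) k t with hX
  have hXp : ∀ k ∈ X, work (npRun J m') k t < (J k).p ∧ (J k).r < t ∧ (J k).d ≤ D := by
    intro k hk
    simp only [hX, hR, Finset.mem_filter, Finset.mem_univ, true_and, work_startRun] at hk
    have := hs k
    omega
  by_cases hA : ∃ k ∈ X, (work (npRun J m') k t : ℚ) ≤ α * (t - (J k).r)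
  · -- some lagging job has mostly waited since its release
    obtain ⟨k, hk, hw⟩ := hA
    obtain ⟨hp, hrt, hkD⟩ := hXp k hk
    obtain ⟨b, rfl⟩ := Nat.exists_eq_add_of_le hrt.le
    have h1 := ih _ hrt (by omega)
    have h2 := le_sum_work_add (npRun J m') R (m := m') k (J k).r b fun u hu =>
      mem_npRun_or_busy hval hagree (Nat.le_add_right _ _) hkD
        ((work_mono _ k (by omega)).trans_lt hp)
    have h3 := sum_work_add_le (startRun J s) R hcap (J k).r b
    have h2' : ((∑ i ∈ R, work (npRun J m') i (J k).r : ℕ) : ℚ) + m' * b ≤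
        (∑ i ∈ R, work (npRun J m') i ((J k).r + b) : ℕ) +
          m' * work (npRun J m') k ((J k).r + b) := by exact_mod_cast h2
    have h3' : ((∑ i ∈ R, work (startRun J s) i ((J k).r + b) : ℕ) : ℚ) ≤
        (∑ i ∈ R, work (startRun J s) i (J k).r : ℕ) + m * b := by exact_mod_cast h3
    push_cast at hw ⊢
    push_cast at h1 h2' h3'
    have h4 : (m' : ℚ) * work (npRun J m') k ((J k).r + b) ≤ m' * (α * b) := by
      gcongr
      linarith
    have h5 : (m : ℚ) / (1 - α) * b ≤ m' * (1 - α) * b := by gcongr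
    have h6 : (m : ℚ) / (1 - α) = α / (1 - α) * m + m := by
      rw [div_eq_mul_one_div, ← hρ']; ring
    rw [h6] at h5
    linarith
  · push Not at hA
    by_cases hq : (m : ℚ) / (1 - α) ≤ X.card
    · -- many lagging jobs are in process, so EDF catches up in the last slot
      cases t with
      | zero =>
        simp only [work_zero, Finset.sum_const_zero]
        push_cast
        push_cast at htD
        positivity
      | succ t =>
        have h1 := ih t (Nat.lt_succ_self t) (by omega)
        have hsub : X ⊆ R ∩ npRun J m' t := by
          intro k hk
          obtain ⟨hp, hrt, hkD⟩ := hXp k hk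
          have hw := hA k hk
          refine Finset.mem_inter.2 ⟨(Finset.mem_filter.1 hk).1, mem_npRun_of_work ?_ hp⟩
          have h : (0 : ℚ) ≤ α * (((t + 1 : ℕ) : ℚ) - (J k).r) := by
            have : ((J k).r : ℚ) ≤ ((t + 1 : ℕ) : ℚ) := by exact_mod_cast hrt.le
            exact mul_nonneg hα0.le (by linarith)
          exact_mod_cast h.trans_lt hw
        have h2 := Finset.card_le_card hsub
        have h3 := sum_work_add_le (startRun J s) R hcap t 1
        have h4 := sum_work_succ (npRun J m') R t
        have h4' : ((∑ k ∈ R, work (npRun J m') k t : ℕ) : ℚ) + X.card ≤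
            (∑ k ∈ R, work (npRun J m') k (t + 1) : ℕ) := by
          rw [h4]; exact_mod_cast Nat.add_le_add_left h2 _
        have h3' : ((∑ k ∈ R, work (startRun J s) k (t + 1) : ℕ) : ℚ) ≤
            (∑ k ∈ R, work (startRun J s) k t : ℕ) + m * 1 := by exact_mod_cast h3
        have h6 : (m : ℚ) / (1 - α) = α / (1 - α) * m + m := by
          rw [div_eq_mul_one_div, ← hρ']; ring
        rw [h6] at hq
        push_cast at *
        linarith
    · -- few lagging jobs, each with little remaining work
      push Not at hq
      have hterm : ∀ k ∈ R, (work (startRun J s) k t : ℚ) ≤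
          work (npRun J m') k t + if k ∈ X then α * (D - t) else 0 := by
        intro k hkR
        split_ifs with hk
        · obtain ⟨hp, hrt, hkD⟩ := hXp k hk
          have hw := hA k hk
          have h1 : (work (startRun J s) k t : ℚ) ≤ (J k).p := by
            rw [work_startRun]; exact_mod_cast min_le_left _ _
          have h2 : α * ((J k).d : ℚ) ≤ α * D := by
            gcongr
          linarith [hloose k]
        · have : work (startRun J s) k t ≤ work (npRun J m') k t := by
            by_contra hlt
            exact hk (Finset.mem_filter.2 ⟨hkR, not_le.1 hlt⟩)
          rw [add_zero]
          exact_mod_cast this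
      have hsum := Finset.sum_le_sum hterm
      rw [Finset.sum_add_distrib, ← Finset.sum_filter, Finset.sum_const, nsmul_eq_mul] at hsum
      have hXR : R.filter (· ∈ X) = X := by
        rw [Finset.filter_mem_eq_inter]
        exact Finset.inter_eq_right.2 (Finset.filter_subset _ _)
      rw [hXR] at hsum
      have : (X.card : ℚ) * (α * (D - t)) ≤ m / (1 - α) * (α * (D - t)) := by gcongr
      have h7 : (m : ℚ) / (1 - α) * (α * (D - t)) = α / (1 - α) * m * (D - t) := by ring
      push_cast
      linarith

/-- If `J` has agreeable deadlines, every job is `α`-loose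
(`p_j ≤ α(d_j - r_j)`), and `J` admits a feasible nonpreemptive schedule on `m`
machines, then for every `m' ≥ m/(1-α)²` the nonpreemptive EDF schedule of `J` on
`m'` machines completes every job by its deadline: every job is eventually started at
some time `s_j ≥ r_j` with `s_j + p_j ≤ d_j`. -/
theorem np_edf_agreeable_loose_competitive {n : ℕ} (J : Fin n → Job)
    (hval : ∀ j, (J j).valid)
    (hagree : ∀ j k, (J j).r < (J k).r → (J j).d ≤ (J k).d)
    (α : ℚ) (hα0 : 0 < α) (hα1 : α < 1)
    (hloose : ∀ j, ((J j).p : ℚ) ≤ α * (((J j).d : ℚ) - ((J j).r : ℚ)))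
    (m : ℕ) (hm : FeasibleNP J m)
    (m' : ℕ) (hm' : (m : ℚ) / (1 - α) ^ 2 ≤ (m' : ℚ)) :
    ∀ j, ∃ T, j ∈ (npState J m' T).1 ∧
      (J j).r ≤ (npState J m' T).2 j ∧
      (npState J m' T).2 j + (J j).p ≤ (J j).d := by
  intro j
  obtain ⟨s, hs, hcap⟩ := hm
  have hcap' : ∀ t, (startRun J s t).card ≤ m := hcap
  have hj := hval j
  obtain ⟨L, hL⟩ := Nat.exists_eq_add_of_le hj.2
  have hL' : (((J j).d : ℕ) : ℚ) = (J j).r + (J j).p + L := by exact_mod_cast hL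
  by_cases hstart : j ∈ (npState J m' ((J j).r + L + 1)).1
  · have hb := npState_start_bounds hstart
    exact ⟨_, hstart, hb.1, by omega⟩
  exfalso
  have hβ : 0 < 1 - α := by linarith
  have hm1 : 0 < m := by
    refine lt_of_lt_of_le (Finset.card_pos.2 ⟨j, ?_⟩) (hcap (s j))
    have := hj.1
    simp only [Finset.mem_filter, Finset.mem_univ, true_and]
    omega
  have hm1' : (0 : ℚ) < m := by exact_mod_cast hm1
  have hm'0 : (0 : ℚ) < m' := lt_of_lt_of_le (by positivity) hm'
  have hm'' : (m : ℚ) / (1 - α) ≤ m' * (1 - α) := by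
    rw [div_le_iff₀ (by positivity)] at hm'
    rw [div_le_iff₀ hβ]
    linarith
  set R : Finset (Fin n) := Finset.univ.filter fun k => (J k).d ≤ (J j).d with hR
  have hlag := sum_work_le_add_lag hval hagree hα0 hα1 hloose (fun k => (hs k).1) hcap' hm'
    (J j).d (J j).r (by omega)
  have hw0 : work (npRun J m') j ((J j).r + (L + 1)) = 0 := by
    rw [work_npRun, ← add_assoc, if_neg hstart]
  have h1 := le_sum_work_add (npRun J m') R (m := m') j (J j).r (L + 1) fun u hu =>
    mem_npRun_or_busy hval hagree (Nat.le_add_right _ _) le_rfl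
      (by have := work_mono (npRun J m') j (show (J j).r + u ≤ (J j).r + (L + 1) by omega)
          have := hj.1
          omega)
  rw [hw0, mul_zero, add_zero] at h1
  have h2 : ∑ k ∈ R, work (npRun J m') k ((J j).r + (L + 1)) ≤
      ∑ k ∈ R, work (startRun J s) k ((J j).r + ((J j).p + L)) := by
    refine Finset.sum_le_sum fun k hk => (work_npRun_le _ _).trans ?_
    rw [work_startRun]
    have := (hs k).2
    have := (Finset.mem_filter.1 hk).2
    omega
  have h3 := h1.trans (h2.trans (sum_work_add_le (startRun J s) R hcap' _ _))
  have h3' : ((∑ k ∈ R, work (npRun J m') k (J j).r : ℕ) : ℚ) + m' * (L + 1) ≤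
      (∑ k ∈ R, work (startRun J s) k (J j).r : ℕ) + m * ((J j).p + L) := by exact_mod_cast h3
  have hρ' : α / (1 - α) + 1 = 1 / (1 - α) := by field_simp; ring
  have h6 : (m : ℚ) / (1 - α) = α / (1 - α) * m + m := by
    rw [div_eq_mul_one_div, ← hρ']; ring
  have hlax : (1 - α) * ((J j).p + L) ≤ L := by
    have := hloose j
    rw [hL'] at this
    linarith
  have h7 : (m' : ℚ) * ((1 - α) * ((J j).p + L)) ≤ m' * L := by gcongr
  have h8 : (m : ℚ) / (1 - α) * ((J j).p + L) ≤ m' * (1 - α) * ((J j).p + L) := by gcongr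
  rw [h6] at h8
  rw [hL'] at hlag
  linarith
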